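/- Let G be a finite simple connected graph with adjacency matrix A and let S be a nonempty set of vertices all of eccentricity e, with eigenvalue support Φ_S = ∪_{s∈S} Φ_s. Then S is pseudo-distance-regular (i.e. |Φ_S| = e+1 and for each 0 ≤ i ≤ e there exists a real polynomial p_i of degree i such that for every s ∈ S and every vertex w, (p_i(A) e_s)_w ≠ 0 if and only if d(s,w) = i) if and only if |Φ_S| = e+1 and there exists a real polynomial p of degree e such that for every s ∈ S and every vertex w, (p(A) e_s)_w ≠ 0 if and only if d(s,w) = e. -/

import Mathlib

open Polynomial Matrix

/-- `u` has eccentricity `e` in `G`. -/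
def IsEcc {V : Type*} (G : SimpleGraph V) (u : V) (e : ℕ) : Prop :=
  (∀ v, G.dist u v ≤ e) ∧ ∃ v, G.dist u v = e

/-- The eigenvalue support of the vertex `u`: those eigenvalues `θ` of `A` whose spectral
idempotent `E_θ` satisfies `E_θ e_u ≠ 0`, equivalently those `θ` admitting an eigenvector
not vanishing at `u`. -/
def eSupport {V : Type*} [Fintype V] (A : Matrix V V ℝ) (u : V) : Set ℝ :=
  {θ : ℝ | ∃ w : V → ℝ, A *ᵥ w = θ • w ∧ w u ≠ 0}

namespace SimpleGraph

variable {V : Type*} [Fintype V] [DecidableEq V] {G : SimpleGraph V} [DecidableRel G.Adj]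

theorem adjMatrix_pow_apply_nonneg (k : ℕ) (u v : V) : 0 ≤ (G.adjMatrix ℝ ^ k) u v := by
  rw [adjMatrix_pow_apply_eq_card_walk]
  positivity

theorem adjMatrix_pow_apply_ne_zero_iff {k : ℕ} {u v : V} :
    (G.adjMatrix ℝ ^ k) u v ≠ 0 ↔ ∃ p : G.Walk u v, p.length = k := by
  rw [adjMatrix_pow_apply_eq_card_walk, Nat.cast_ne_zero, ← Nat.pos_iff_ne_zero,
    Fintype.card_pos_iff]
  exact ⟨fun ⟨p⟩ => ⟨p.1, p.2⟩, fun ⟨p, hp⟩ => ⟨⟨p, hp⟩⟩⟩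

theorem dist_le_of_adjMatrix_pow_apply_ne_zero {k : ℕ} {u v : V}
    (h : (G.adjMatrix ℝ ^ k) v u ≠ 0) : G.dist u v ≤ k := by
  obtain ⟨p, rfl⟩ := adjMatrix_pow_apply_ne_zero_iff.1 h
  rw [dist_comm]
  exact dist_le p

theorem Connected.adjMatrix_pow_dist_apply_pos (hconn : G.Connected) (u v : V) :
    0 < (G.adjMatrix ℝ ^ G.dist u v) v u := by
  refine lt_of_le_of_ne (adjMatrix_pow_apply_nonneg _ _ _) (Ne.symm ?_)
  rw [adjMatrix_pow_apply_ne_zero_iff, dist_comm]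
  exact hconn.exists_walk_length_eq_dist v u

theorem aeval_adjMatrix_apply_of_natDegree_le_dist {p : ℝ[X]} {u v : V}
    (h : p.natDegree ≤ G.dist u v) :
    (aeval (G.adjMatrix ℝ) p) v u =
      p.coeff (G.dist u v) * (G.adjMatrix ℝ ^ G.dist u v) v u := by
  rw [aeval_eq_sum_range' (Nat.lt_succ_of_le h), Matrix.sum_apply,
    Finset.sum_eq_single (G.dist u v)]
  · simp
  · intro k hk hne
    by_contra hk0
    have := dist_le_of_adjMatrix_pow_apply_ne_zero (G := G) (k := k) (u := u) (v := v)
      (fun h0 => hk0 (by simp [h0]))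
    have := Finset.mem_range.1 hk
    omega
  · simp

theorem aeval_adjMatrix_apply_of_degree_lt_dist {p : ℝ[X]} {u v : V}
    (h : p.degree < (G.dist u v : WithBot ℕ)) : (aeval (G.adjMatrix ℝ) p) v u = 0 := by
  rw [aeval_adjMatrix_apply_of_natDegree_le_dist (natDegree_le_of_degree_le h.le),
    coeff_eq_zero_of_degree_lt h, zero_mul]

theorem Connected.exists_adj_dist_eq (hconn : G.Connected) {u v : V} {k : ℕ}
    (h : G.dist u v = k + 1) : ∃ w, G.Adj w v ∧ G.dist u w = k := by
  have hpos := hconn.adjMatrix_pow_dist_apply_pos u v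
  rw [h, pow_succ', Matrix.mul_apply] at hpos
  obtain ⟨w, -, hw⟩ := Finset.exists_ne_zero_of_sum_ne_zero hpos.ne'
  have hadj : G.Adj v w := by
    by_contra hn
    simp [hn] at hw
  have hle := dist_le_of_adjMatrix_pow_apply_ne_zero (right_ne_zero_of_mul hw)
  have htri := hconn.dist_triangle (u := u) (v := w) (w := v)
  rw [dist_eq_one_iff_adj.2 hadj.symm] at htri
  exact ⟨w, hadj.symm, by omega⟩

theorem Connected.exists_dist_eq (hconn : G.Connected) {u v : V} {k : ℕ}
    (h : k ≤ G.dist u v) : ∃ w, G.dist u w = k := by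
  induction h using Nat.decreasingInduction with
  | self => exact ⟨v, rfl⟩
  | of_succ k _ ih =>
    obtain ⟨w, hw⟩ := ih
    obtain ⟨x, -, hx⟩ := hconn.exists_adj_dist_eq hw
    exact ⟨x, hx⟩

/-- `p` is a polynomial of degree `i` such that, for every `s ∈ S`, the support of `p(A) e_s` is
the sphere of radius `i` about `s`. -/
def IsDistancePolynomial (G : SimpleGraph V) [DecidableRel G.Adj] (S : Set V) (i : ℕ)
    (p : ℝ[X]) : Prop :=
  p.degree = (i : WithBot ℕ) ∧
    ∀ s ∈ S, ∀ w, (aeval (G.adjMatrix ℝ) p) w s ≠ 0 ↔ G.dist s w = i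

namespace IsDistancePolynomial

variable {S : Set V} {i : ℕ} {p : ℝ[X]}

theorem apply_eq_zero (hp : IsDistancePolynomial G S i p) {s w : V} (hs : s ∈ S)
    (hw : G.dist s w ≠ i) : (aeval (G.adjMatrix ℝ) p) w s = 0 := by
  by_contra h
  exact hw ((hp.2 s hs w).1 h)

theorem adjMatrix_mul_apply_eq_zero (hp : IsDistancePolynomial G S i p) (hconn : G.Connected)
    {s w : V} (hs : s ∈ S) (hw : G.dist s w + 1 < i) :
    (aeval (G.adjMatrix ℝ) (X * p)) w s = 0 := by
  rw [map_mul, aeval_X, adjMatrix_mul_apply]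
  refine Finset.sum_eq_zero fun v hv => hp.apply_eq_zero hs ?_
  have htri := hconn.dist_triangle (u := s) (v := w) (w := v)
  rw [dist_eq_one_iff_adj.2 ((mem_neighborFinset _ _ _).1 hv)] at htri
  omega

theorem exists_adjMatrix_mul_apply_ne_zero (hp : IsDistancePolynomial G S (i + 1) p)
    (hconn : G.Connected) {s v : V} (hs : s ∈ S) (hv : i + 1 ≤ G.dist s v) :
    ∃ w, G.dist s w = i ∧ (aeval (G.adjMatrix ℝ) (X * p)) w s ≠ 0 := by
  obtain ⟨x, hx⟩ := hconn.exists_dist_eq hv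
  obtain ⟨w, hadj, hw⟩ := hconn.exists_adj_dist_eq hx
  refine ⟨w, hw, fun h0 => ?_⟩
  rw [map_mul, aeval_X, adjMatrix_mul_apply] at h0
  have hnonneg : ∀ y ∈ G.neighborFinset w,
      0 ≤ p.coeff (i + 1) * (aeval (G.adjMatrix ℝ) p) y s := by
    intro y _
    by_cases hy : G.dist s y = i + 1
    · rw [aeval_adjMatrix_apply_of_natDegree_le_dist
        (by rw [hy, natDegree_eq_of_degree_eq_some hp.1]), hy, ← mul_assoc]
      exact mul_nonneg (mul_self_nonneg _) (adjMatrix_pow_apply_nonneg _ _ _)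
    · rw [hp.apply_eq_zero hs hy, mul_zero]
  have hsum := (Finset.sum_eq_zero_iff_of_nonneg hnonneg).1
    (by rw [← Finset.mul_sum, h0, mul_zero]) x ((mem_neighborFinset _ _ _).2 hadj)
  exact mul_ne_zero (coeff_ne_zero_of_eq_degree hp.1) ((hp.2 s hs x).2 hx) hsum

end IsDistancePolynomial

/-- Within distance less than `i` of each `s ∈ S`, the vectors `f(A) e_s` with `deg f ≤ e` are
realised by polynomials of degree less than `i`, uniformly in `s`. -/
def ReducesBelow (G : SimpleGraph V) [DecidableRel G.Adj] (S : Set V) (e i : ℕ) : Prop :=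
  ∀ f : ℝ[X], f.degree < ((e + 1 : ℕ) : WithBot ℕ) → ∃ r : ℝ[X], r.degree < (i : WithBot ℕ) ∧
    ∀ s ∈ S, ∀ w, G.dist s w < i →
      (aeval (G.adjMatrix ℝ) r) w s = (aeval (G.adjMatrix ℝ) f) w s

theorem ReducesBelow.of_succ {S : Set V} {e i : ℕ} {p : ℝ[X]}
    (h : ReducesBelow G S e (i + 1)) (hp : IsDistancePolynomial G S i p) :
    ReducesBelow G S e i := by
  intro f hf
  obtain ⟨r, hr, hrf⟩ := h f hf
  refine ⟨r - C (r.coeff i / p.coeff i) * p, ?_, fun s hs w hw => ?_⟩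
  · rw [degree_lt_iff_coeff_zero] at hr ⊢
    intro m hm
    rw [coeff_sub, coeff_C_mul]
    obtain rfl | hlt := hm.eq_or_lt
    · rw [div_mul_cancel₀ _ (coeff_ne_zero_of_eq_degree hp.1), sub_self]
    · rw [hr m hlt, coeff_eq_zero_of_degree_lt (p := p) (n := m) (by rw [hp.1]; exact_mod_cast hlt)]
      simp
  · rw [map_sub, Matrix.sub_apply, hrf s hs w (by omega), map_mul, aeval_C,
      ← Algebra.smul_def, Matrix.smul_apply, hp.apply_eq_zero hs hw.ne, smul_zero, sub_zero]

theorem IsDistancePolynomial.exists_pred {S : Set V} {e i : ℕ} {p M : ℝ[X]}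
    (hp : IsDistancePolynomial G S (i + 1) p) (hred : ReducesBelow G S e (i + 1))
    (hconn : G.Connected) (hS : S.Nonempty) (hecc : ∀ s ∈ S, ∃ v, i + 1 ≤ G.dist s v)
    (hM : M.Monic) (hdeg : M.natDegree = e + 1)
    (hann : ∀ s ∈ S, aeval (G.adjMatrix ℝ) M *ᵥ Pi.single s 1 = 0) :
    ∃ q, IsDistancePolynomial G S i q := by
  obtain ⟨r, hr, hrf⟩ := hred ((X * p) %ₘ M) <| by
    rw [← hdeg, ← degree_eq_natDegree hM.ne_zero]
    exact degree_modByMonic_lt _ hM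
  replace hrf : ∀ s ∈ S, ∀ w, G.dist s w < i + 1 →
      (aeval (G.adjMatrix ℝ) r) w s = (aeval (G.adjMatrix ℝ) (X * p)) w s := by
    intro s hs w hw
    have hzero : (aeval (G.adjMatrix ℝ) (M * ((X * p) /ₘ M))) w s = 0 := by
      have : (aeval (G.adjMatrix ℝ) ((X * p) /ₘ M) *ᵥ
          (aeval (G.adjMatrix ℝ) M *ᵥ Pi.single s 1)) w = 0 := by
        rw [hann s hs, Matrix.mulVec_zero, Pi.zero_apply]
      rwa [Matrix.mulVec_mulVec, Matrix.mulVec_single_one, Matrix.col_apply, ← map_mul,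
        mul_comm] at this
    rw [hrf s hs w hw]
    conv_rhs => rw [← modByMonic_add_div (X * p) M, map_add, Matrix.add_apply, hzero, add_zero]
  have hle : r.degree ≤ (i : WithBot ℕ) := by
    rw [degree_le_iff_coeff_zero]
    intro m hm
    exact (degree_lt_iff_coeff_zero _ _).1 hr m (Nat.succ_le_of_lt (by exact_mod_cast hm))
  have hr_deg : r.degree = (i : WithBot ℕ) := by
    refine hle.eq_of_not_lt fun hlt => ?_
    obtain ⟨s, hs⟩ := hS
    obtain ⟨v, hv⟩ := hecc s hs
    obtain ⟨w, hw, hne⟩ := hp.exists_adjMatrix_mul_apply_ne_zero hconn hs hv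
    rw [← hrf s hs w (by omega)] at hne
    exact hne (aeval_adjMatrix_apply_of_degree_lt_dist (by rwa [hw]))
  refine ⟨r, hr_deg, fun s hs w => ⟨fun hne => ?_, fun hw => ?_⟩⟩
  · by_contra hw
    obtain hlt | hgt := Nat.lt_or_gt_of_ne hw
    · rw [hrf s hs w (by omega)] at hne
      exact hne (hp.adjMatrix_mul_apply_eq_zero hconn hs (by omega))
    · exact hne (aeval_adjMatrix_apply_of_degree_lt_dist
        (by rw [hr_deg]; exact_mod_cast hgt))
  · rw [aeval_adjMatrix_apply_of_natDegree_le_dist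
      (by rw [hw]; exact natDegree_le_of_degree_le hle), hw]
    refine mul_ne_zero (coeff_ne_zero_of_eq_degree hr_deg) ?_
    rw [← hw]
    exact (hconn.adjMatrix_pow_dist_apply_pos s w).ne'

end SimpleGraph

theorem Matrix.aeval_mulVec_of_mulVec_eq_smul {V : Type*} [Fintype V] [DecidableEq V]
    {A : Matrix V V ℝ} {θ : ℝ} {w : V → ℝ} (h : A *ᵥ w = θ • w) (p : ℝ[X]) :
    aeval A p *ᵥ w = p.eval θ • w := by
  induction p using Polynomial.induction_on' with
  | add p q hp hq => rw [map_add, Matrix.add_mulVec, hp, hq, eval_add, add_smul]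
  | monomial n a =>
    have hpow : A ^ n *ᵥ w = θ ^ n • w := by
      induction n with
      | zero => simp
      | succ n ih => rw [pow_succ, ← Matrix.mulVec_mulVec, h, Matrix.mulVec_smul, ih, smul_smul,
          pow_succ']
    rw [aeval_monomial, ← Algebra.smul_def, Matrix.smul_mulVec, hpow, eval_monomial, smul_smul]

theorem Matrix.IsHermitian.aeval_mulVec_single_eq_zero {V : Type*} [Fintype V] [DecidableEq V]
    {A : Matrix V V ℝ} (hA : A.IsHermitian) {s : V} {p : ℝ[X]}
    (hp : ∀ θ ∈ eSupport A s, p.eval θ = 0) : aeval A p *ᵥ Pi.single s 1 = 0 := by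
  have hexp : (Pi.single s 1 : V → ℝ) =
      ∑ j, (hA.eigenvectorBasis j) s • ⇑(hA.eigenvectorBasis j) := by
    have := congrArg WithLp.ofLp
      (hA.eigenvectorBasis.sum_repr (EuclideanSpace.single s (1 : ℝ)))
    simpa [OrthonormalBasis.repr_apply_apply, EuclideanSpace.inner_single_right] using this.symm
  rw [hexp, Matrix.mulVec_sum]
  refine Finset.sum_eq_zero fun j _ => ?_
  rw [Matrix.mulVec_smul, Matrix.aeval_mulVec_of_mulVec_eq_smul (hA.mulVec_eigenvectorBasis j)]
  by_cases hs : (hA.eigenvectorBasis j) s = 0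
  · rw [hs, zero_smul]
  · rw [hp _ ⟨_, hA.mulVec_eigenvectorBasis j, hs⟩, zero_smul, smul_zero]

theorem set_pseudo_distance_regular_iff_last_polynomial
    {V : Type*} [Fintype V] [DecidableEq V] (G : SimpleGraph V) [DecidableRel G.Adj]
    (hconn : G.Connected) (S : Set V) (hS : S.Nonempty)
    (e : ℕ) (hecc : ∀ s ∈ S, IsEcc G s e) :
    ((⋃ s ∈ S, eSupport (G.adjMatrix ℝ) s).ncard = e + 1 ∧
      ∀ i ≤ e, ∃ p : Polynomial ℝ, p.degree = (i : WithBot ℕ) ∧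
        ∀ s ∈ S, ∀ w, (aeval (G.adjMatrix ℝ) p *ᵥ Pi.single s 1) w ≠ 0 ↔ G.dist s w = i) ↔
    ((⋃ s ∈ S, eSupport (G.adjMatrix ℝ) s).ncard = e + 1 ∧
      ∃ p : Polynomial ℝ, p.degree = (e : WithBot ℕ) ∧
        ∀ s ∈ S, ∀ w, (aeval (G.adjMatrix ℝ) p *ᵥ Pi.single s 1) w ≠ 0 ↔ G.dist s w = e) := by
  refine and_congr_right fun hcard => ⟨fun h => h e le_rfl, fun ⟨p, hp⟩ => ?_⟩
  set Φ := ⋃ s ∈ S, eSupport (G.adjMatrix ℝ) s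
  have hfin : Φ.Finite := Set.finite_of_ncard_ne_zero (by omega)
  have hann : ∀ s ∈ S,
      aeval (G.adjMatrix ℝ) (∏ θ ∈ hfin.toFinset, (X - C θ)) *ᵥ Pi.single s 1 = 0 := by
    intro s hs
    refine Matrix.IsHermitian.aeval_mulVec_single_eq_zero
      (by simp [Matrix.IsHermitian]) fun θ hθ => ?_
    rw [eval_prod]
    exact Finset.prod_eq_zero (hfin.mem_toFinset.2 (Set.mem_biUnion hs hθ)) (by simp)
  have hdeg : (∏ θ ∈ hfin.toFinset, (X - C θ)).natDegree = e + 1 := by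
    rw [natDegree_finsetProd_X_sub_C_eq_card, ← Set.ncard_eq_toFinset_card _ hfin, hcard]
  have key : ∀ i ≤ e, G.ReducesBelow S e (i + 1) ∧ ∃ q, G.IsDistancePolynomial S i q := by
    intro i hi
    induction hi using Nat.decreasingInduction with
    | self =>
      exact ⟨fun f hf => ⟨f, hf, fun _ _ _ _ => rfl⟩, p, hp.1, fun s hs w => by
        simpa using hp.2 s hs w⟩
    | of_succ i hi ih =>
      obtain ⟨hred, q, hq⟩ := ih
      refine ⟨hred.of_succ hq, hq.exists_pred (hred.of_succ hq) hconn hS (fun s hs => ?_)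
        (monic_prod_of_monic _ _ fun θ _ => monic_X_sub_C θ) hdeg hann⟩
      obtain ⟨v, hv⟩ := (hecc s hs).2
      exact ⟨v, by omega⟩
  intro i hi
  obtain ⟨-, q, hq⟩ := key i hi
  exact ⟨q, hq.1, fun s hs w => by simpa using hq.2 s hs w⟩
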